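/- Let p be an odd prime, r = (p−1)/2, K = CyclotomicField p ℚ, ζ ∈ K a primitive p-th root of unity, c an integer with p ∤ c, and g = Σ_{x ∈ ZMod p} ζ^{x²}. Let m = ∏_{j=0}^{r} (X − ζ^{c·j²}) ∈ K[X]. Then every coefficient of m lies in the ring ℤ[(1+g)/2]: for every natural number k there exist integers a, b such that the coefficient of X^k in m equals a + b·(1+g)/2. -/

import Mathlib

open Polynomial

section FiniteField

variable {F K : Type*} [Field F] [Fintype F] [Field K]

lemma exists_coeff_prod_X_sub_C_addChar_eq_sum (ψ : AddChar F K) (S : Finset F) (k : ℕ) :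
    ∃ f : F → ℤ, (∏ s ∈ S, (X - C (ψ s))).coeff k = ∑ x, (f x : K) * ψ x ∧
      ∀ u : F, u ≠ 0 → (∀ s, s ∈ S → u * s ∈ S) → ∀ x, f (u * x) = f x := by
  let M : (AddMonoidAlgebra ℤ F)[X] := ∏ s ∈ S, (X - C (AddMonoidAlgebra.single s (1 : ℤ)))
  refine ⟨(M.coeff k).coeff, ?_, fun u hu hS x => ?_⟩
  · have hM : M.map (AddMonoidAlgebra.lift ℤ K F ψ.toMonoidHom : AddMonoidAlgebra ℤ F →+* K)
        = ∏ s ∈ S, (X - C (ψ s)) := by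
      simp [M, Polynomial.map_prod]
    rw [← hM, coeff_map]
    simp [AddMonoidAlgebra.lift_apply, Finsupp.sum_fintype]
  · let σ := AddMonoidAlgebra.mapDomainRingHom ℤ (AddMonoidHom.mulLeft u)
    have hσ : M.map σ = M := by
      simp only [M, Polynomial.map_prod, Polynomial.map_sub, map_X, map_C]
      refine Finset.prod_nbij (fun s => u * s) hS (mul_right_injective₀ hu).injOn ?_ ?_
      · exact Finset.surjOn_of_injOn_of_card_le _ hS (mul_right_injective₀ hu).injOn le_rfl
      · intro s _
        simp [σ, AddMonoidAlgebra.mapDomain_single]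
    have h := congrArg (fun P => (P.coeff k).coeff (u * x)) hσ
    simp only [coeff_map] at h
    rw [← h]
    exact Finsupp.mapDomain_apply (mul_right_injective₀ hu) _ x

variable [DecidableEq F]

lemma exists_two_mul_eq_add_mul_quadraticChar (hF : ringChar F ≠ 2) (f : F → ℤ)
    (hf : ∀ u : F, u ≠ 0 → ∀ x, f (u ^ 2 * x) = f x) :
    ∃ A B : ℤ, ∀ x, x ≠ 0 → 2 * f x = (A + B) + (A - B) * quadraticChar F x := by
  obtain ⟨n, hn⟩ := quadraticChar_exists_neg_one hF
  have hn0 : n ≠ 0 := by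
    rintro rfl
    simp at hn
  have key : ∀ x y : F, x ≠ 0 → y ≠ 0 → quadraticChar F x = quadraticChar F y → f x = f y := by
    intro x y hx hy hxy
    have hsq : IsSquare (x * y) := by
      rw [← quadraticChar_one_iff_isSquare (mul_ne_zero hx hy), map_mul, hxy, ← sq,
        quadraticChar_sq_one hy]
    obtain ⟨z, hz⟩ := hsq
    have hz0 : z ≠ 0 := by
      rintro rfl
      simp_all
    have : x = (z / y) ^ 2 * y := by
      field_simp
      rw [hz, sq]
    rw [this, hf _ (div_ne_zero hz0 hy)]
  refine ⟨f 1, f n, fun x hx => ?_⟩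
  rcases quadraticChar_dichotomy hx with h | h
  · rw [key x 1 hx one_ne_zero (by rw [h, map_one]), h]
    ring
  · rw [key x n hx hn0 (by rw [h, hn]), h]
    ring

lemma sum_addChar_sq_eq_sum_quadraticChar_mul (hF : ringChar F ≠ 2) {ψ : AddChar F K}
    (hψ : ψ ≠ 1) : ∑ x, ψ (x ^ 2) = ∑ x, (quadraticChar F x : K) * ψ x := by
  have h : ∑ x, ψ (x ^ 2) = ∑ y, ((quadraticChar F y + 1 : ℤ) : K) * ψ y := by
    rw [← Finset.sum_fiberwise Finset.univ (fun x : F => x ^ 2)]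
    refine Finset.sum_congr rfl fun y _ => ?_
    rw [← quadraticChar_card_sqrts hF y,
      Finset.sum_congr rfl (g := fun _ => ψ y) fun x hx => by rw [(Finset.mem_filter.mp hx).2]]
    simp [Set.toFinset_ofPred]
  simp only [h, Int.cast_add, Int.cast_one, add_mul, one_mul, Finset.sum_add_distrib,
    AddChar.sum_eq_zero_of_ne_one hψ, add_zero]

lemma exists_sum_mul_addChar_eq (hF : ringChar F ≠ 2) (hK : (2 : K) ≠ 0) {ψ : AddChar F K}
    (hψ : ψ ≠ 1) (f : F → ℤ) (hf : ∀ u : F, u ≠ 0 → ∀ x, f (u ^ 2 * x) = f x) :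
    ∃ a b : ℤ, ∑ x, (f x : K) * ψ x = a + b * ((1 + ∑ x, ψ (x ^ 2)) / 2) := by
  obtain ⟨A, B, h⟩ := exists_two_mul_eq_add_mul_quadraticChar hF f hf
  refine ⟨f 0 - A, A - B, ?_⟩
  have h2 : ∀ x, 2 * ((f x : K) * ψ x) = (A + B : K) * ψ x
      + (A - B : K) * ((quadraticChar F x : K) * ψ x)
      + if x = 0 then (2 * f 0 - A - B : K) else 0 := by
    intro x
    by_cases hx : x = 0
    · subst hx
      simp
    · have := congrArg (Int.cast : ℤ → K) (h x hx)
      push_cast at this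
      rw [if_neg hx, ← mul_assoc, this]
      ring
  have h3 : 2 * ∑ x, (f x : K) * ψ x
      = (A - B : K) * ∑ x, ψ (x ^ 2) + (2 * f 0 - A - B : K) := by
    rw [Finset.mul_sum, Finset.sum_congr rfl fun x _ => h2 x, Finset.sum_add_distrib,
      Finset.sum_add_distrib, ← Finset.mul_sum, ← Finset.mul_sum,
      AddChar.sum_eq_zero_of_ne_one hψ, sum_addChar_sq_eq_sum_quadraticChar_mul hF hψ]
    simp
  apply mul_left_cancel₀ hK
  rw [h3]
  push_cast
  field_simp
  ring

end FiniteField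

lemma ZMod.exists_le_sq_eq_sq {p : ℕ} [NeZero p] (x : ZMod p) :
    ∃ j ≤ p / 2, (j : ZMod p) ^ 2 = x ^ 2 := by
  refine ⟨x.valMinAbs.natAbs, x.natAbs_valMinAbs_le, ?_⟩
  rw [ZMod.natCast_natAbs_valMinAbs]
  split_ifs <;> simp

lemma ZMod.eq_of_sq_eq_sq_of_le_half {p : ℕ} [Fact p.Prime] {i j : ℕ}
    (hi : i ≤ p / 2) (hj : j ≤ p / 2) (h : (i : ZMod p) ^ 2 = (j : ZMod p) ^ 2) : i = j := by
  have hval : (i : ZMod p).valMinAbs.natAbs = (j : ZMod p).valMinAbs.natAbs :=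
    ZMod.natAbs_valMinAbs_eq_natAbs_valMinAbs.mpr (sq_eq_sq_iff_eq_or_eq_neg.mp h)
  rwa [ZMod.valMinAbs_natCast_of_le_half hi, ZMod.valMinAbs_natCast_of_le_half hj,
    Int.natAbs_natCast, Int.natAbs_natCast] at hval

lemma AddChar.zmodChar_intCast {n : ℕ} [NeZero n] {K : Type*} [Field K] {ζ : K} (hζ : ζ ^ n = 1)
    (a : ℤ) : AddChar.zmodChar n hζ (a : ZMod n) = ζ ^ a := by
  have h0 : ζ ≠ 0 := by
    rintro rfl
    simp [NeZero.ne n] at hζ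
  rw [AddChar.zmodChar_apply, ← zpow_natCast, ZMod.val_intCast]
  conv_rhs => rw [← Int.emod_add_mul_ediv a n, zpow_add₀ h0, zpow_mul, zpow_natCast, hζ]
  simp

/-- (Theorem 4 / part of Theorem `thm1` of the paper.)  The
characteristic polynomial `m = ∏_{j=0}^{r} (X - ζ^{c·j²})` of the matrix `T'` has all
its coefficients in the quadratic ring `ℤ[(1+g)/2]`, where `g` is the quadratic Gauss
sum. -/
theorem char_poly_coeffs_in_quadratic_ring
    (p : ℕ+) [hp : Fact (p : ℕ).Prime] (hp2 : (p : ℕ) ≠ 2)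
    (r : ℕ) (hr : r = ((p : ℕ) - 1) / 2)
    (ζ : CyclotomicField p ℚ) (hζ : IsPrimitiveRoot ζ (p : ℕ))
    (c : ℤ) (hc : ¬ ((p : ℕ) : ℤ) ∣ c)
    (g : CyclotomicField p ℚ)
    (hg : g = ∑ x : ZMod (p : ℕ), ζ ^ ((x.val : ℤ) ^ 2))
    (m : Polynomial (CyclotomicField p ℚ))
    (hm : m = ∏ j : Fin (r + 1), (X - C (ζ ^ (c * ((j : ℕ) : ℤ) ^ 2)))) :
    ∀ k : ℕ, ∃ a b : ℤ, m.coeff k = (a : CyclotomicField p ℚ) +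
      (b : CyclotomicField p ℚ) * ((1 + g) / 2) := by
  have : NeZero (p : ℕ) := ⟨hp.out.ne_zero⟩
  have hr' : r = (p : ℕ) / 2 := by
    have := hp.out.eq_two_or_odd
    omega
  have hF : ringChar (ZMod (p : ℕ)) ≠ 2 := by rwa [ZMod.ringChar_zmod_n]
  have hc0 : (c : ZMod (p : ℕ)) ≠ 0 := by rwa [Ne, ZMod.intCast_zmod_eq_zero_iff_dvd]
  let ψ := AddChar.zmodChar (p : ℕ) hζ.pow_eq_one
  have hψ : ψ ≠ 1 := by
    rw [AddChar.zmod_char_ne_one_iff]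
    have h1 := AddChar.zmodChar_intCast hζ.pow_eq_one 1
    rw [Int.cast_one, zpow_one] at h1
    rw [h1]
    exact hζ.ne_one hp.out.one_lt
  have hg' : g = ∑ x, ψ (x ^ 2) := by
    rw [hg]
    refine Finset.sum_congr rfl fun x _ => ?_
    rw [← AddChar.zmodChar_intCast hζ.pow_eq_one]
    simp [ψ]
  let S : Finset (ZMod (p : ℕ)) := Finset.univ.image fun x => (c : ZMod (p : ℕ)) * x ^ 2
  have hm' : m = ∏ s ∈ S, (X - C (ψ s)) := by
    rw [hm]
    refine Finset.prod_nbij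
      (fun j : Fin (r + 1) => (c : ZMod (p : ℕ)) * ((j : ℕ) : ZMod (p : ℕ)) ^ 2)
      (fun j _ => Finset.mem_image_of_mem _ (Finset.mem_univ _)) ?_ ?_ ?_
    · intro i _ j _ hij
      exact Fin.ext (ZMod.eq_of_sq_eq_sq_of_le_half (by omega) (by omega)
        (mul_left_cancel₀ hc0 hij))
    · intro s hs
      obtain ⟨x, -, rfl⟩ := Finset.mem_image.mp hs
      obtain ⟨j, hj, hjx⟩ := ZMod.exists_le_sq_eq_sq x
      exact ⟨⟨j, by omega⟩, by simp, by simp [hjx]⟩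
    · intro j _
      rw [← AddChar.zmodChar_intCast hζ.pow_eq_one]
      simp [ψ]
  intro k
  obtain ⟨f, hf, hinv⟩ := exists_coeff_prod_X_sub_C_addChar_eq_sum ψ S k
  rw [hm', hf, hg']
  refine exists_sum_mul_addChar_eq hF two_ne_zero hψ f fun u hu =>
    hinv _ (pow_ne_zero 2 hu) fun s hs => ?_
  obtain ⟨x, -, rfl⟩ := Finset.mem_image.mp hs
  exact Finset.mem_image.mpr ⟨u * x, Finset.mem_univ _, by ring⟩
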